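/- Let n be a positive integer and let B be a real number with (2+B)_n ≠ 0, 1+2n+3B ≠ 0, and (B+(2n+1)/3)_{⌊n/2⌋} ≠ 0. Then ∑_{k=0}^{⌊n/2⌋} [ (4/3+2n/3+B)_k · (1−2n/3)_k · (−n/2)_k · ((1−n)/2)_k · (−1−2n−B)_k · (2n+2B)_k ] / [ k! · (1/3+2n/3+B)_k · (−2n/3)_k · (1−n)_k · (1+B/2)_k · (3/2+B/2)_k ] = (1/2) · (1+5n+3B)/(1+2n+3B) · (2n+2B)_n/(2+B)_n. (Lemma A6, a terminating 6F5 summation) -/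

import Mathlib

open Finset

/-- The Pochhammer symbol `(a)_k = a(a+1)⋯(a+k-1)` for a real `a`. -/
noncomputable def poch (a : ℝ) (k : ℕ) : ℝ := ∏ i ∈ Finset.range k, (a + i)

theorem poch_succ (a : ℝ) (k : ℕ) : poch a (k + 1) = poch a k * (a + k) :=
  Finset.prod_range_succ _ _

theorem poch_zero (a : ℝ) : poch a 0 = 1 := Finset.prod_range_zero _

theorem poch_add (a : ℝ) (m k : ℕ) : poch a (m + k) = poch a m * poch (a + m) k := by
  induction k with
  | zero => simp [poch_zero]
  | succ k ih => rw [← add_assoc, poch_succ, poch_succ, ih]; push_cast; ring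

theorem poch_succ' (a : ℝ) (k : ℕ) : poch a (k + 1) = a * poch (a + 1) k := by
  rw [add_comm, poch_add, poch_succ, poch_zero]; simp

/-- Raising the parameter of a Pochhammer symbol by one. -/
theorem mul_poch_add_one (a : ℝ) (k : ℕ) : a * poch (a + 1) k = poch a k * (a + k) := by
  rw [← poch_succ', poch_succ]

theorem poch_ne_zero {a : ℝ} {k : ℕ} (h : ∀ i < k, a + i ≠ 0) : poch a k ≠ 0 :=
  Finset.prod_ne_zero_iff.2 fun i hi => h i (Finset.mem_range.1 hi)

theorem add_ne_zero_of_poch_ne_zero {a : ℝ} {k i : ℕ} (h : poch a k ≠ 0) (hi : i < k) :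
    a + i ≠ 0 :=
  Finset.prod_ne_zero_iff.1 h i (Finset.mem_range.2 hi)

/-- The duplication formula for Pochhammer symbols. -/
theorem poch_two_mul (a : ℝ) (k : ℕ) :
    poch a (2 * k) = 4 ^ k * (poch (a / 2) k * poch ((a + 1) / 2) k) := by
  induction k with
  | zero => simp [poch_zero]
  | succ k ih =>
    rw [show 2 * (k + 1) = 2 * k + 1 + 1 by ring, poch_succ, poch_succ, poch_succ, poch_succ, ih]
    push_cast; ring

/-- Functions `ℝ → ℝ` given by a polynomial. -/
def IsPolyFun (f : ℝ → ℝ) : Prop := ∃ p : Polynomial ℝ, ∀ x, p.eval x = f x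

namespace IsPolyFun

theorem const (c : ℝ) : IsPolyFun fun _ => c := ⟨Polynomial.C c, by simp⟩

theorem id : IsPolyFun fun x => x := ⟨Polynomial.X, by simp⟩

theorem add {f g : ℝ → ℝ} (hf : IsPolyFun f) (hg : IsPolyFun g) :
    IsPolyFun fun x => f x + g x := by
  obtain ⟨p, hp⟩ := hf
  obtain ⟨q, hq⟩ := hg
  exact ⟨p + q, by simp [hp, hq]⟩

theorem mul {f g : ℝ → ℝ} (hf : IsPolyFun f) (hg : IsPolyFun g) :
    IsPolyFun fun x => f x * g x := by
  obtain ⟨p, hp⟩ := hf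
  obtain ⟨q, hq⟩ := hg
  exact ⟨p * q, by simp [hp, hq]⟩

theorem affine (a b : ℝ) : IsPolyFun fun x => a + b * x :=
  (const a).add ((const b).mul id)

theorem comp {f g : ℝ → ℝ} (hf : IsPolyFun f) (hg : IsPolyFun g) :
    IsPolyFun fun x => f (g x) := by
  obtain ⟨p, hp⟩ := hf
  obtain ⟨q, hq⟩ := hg
  exact ⟨p.comp q, by simp [hp, hq]⟩

theorem sum {f : ℕ → ℝ → ℝ} (s : Finset ℕ) (hf : ∀ k, IsPolyFun (f k)) :
    IsPolyFun fun x => ∑ k ∈ s, f k x := by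
  choose p hp using hf
  exact ⟨∑ k ∈ s, p k, fun x => by simp [Polynomial.eval_finsetSum, hp]⟩

theorem poch (k : ℕ) : IsPolyFun fun x => poch x k := by
  induction k with
  | zero => simpa only [poch_zero] using const 1
  | succ k ih => simpa only [poch_succ] using ih.mul (id.add (const k))

/-- Two polynomial functions that agree at `c, c - 1, c - 2, …` are equal. -/
theorem eq_of_eq_sub_nat {f g : ℝ → ℝ} (hf : IsPolyFun f) (hg : IsPolyFun g) (c : ℝ)
    (h : ∀ m : ℕ, f (c - m) = g (c - m)) (x : ℝ) : f x = g x := by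
  obtain ⟨p, hp⟩ := hf
  obtain ⟨q, hq⟩ := hg
  have hinj : Function.Injective fun m : ℕ => c - (m : ℝ) := fun i j hij => by simpa using hij
  have hpq : p = q := Polynomial.eq_of_infinite_eval_eq p q <|
    (Set.infinite_range_of_injective hinj).mono <| by
      rintro _ ⟨m, rfl⟩
      simp [hp, hq, h]
  rw [← hp, ← hq, hpq]

end IsPolyFun

/-- The hypergeometric part of the summand, cleared of its denominators in `B`. -/
noncomputable def hypTerm (n : ℕ) (k : ℕ) (B : ℝ) : ℝ :=
  poch (-(n : ℝ)) (2 * k) / ((Nat.factorial k : ℝ) * poch (1 - (n : ℝ)) k) *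
    (poch (-1 - 2 * (n : ℝ) - B) k * poch (2 * (n : ℝ) + 2 * B) k *
      poch (2 + B + 2 * k) (n - 2 * k))

/-- The left-hand side of the summation formula, cleared of its denominators in `B`. -/
noncomputable def hypSum (n : ℕ) (B : ℝ) : ℝ :=
  ∑ k ∈ Finset.range (n / 2 + 1),
    (2 * (n : ℝ) - 3 * k) * (1 + 2 * n + 3 * B + 3 * k) * hypTerm n k B

/-- The polynomial part of the telescoping certificate in `B`. -/
def certPoly (n B k : ℝ) : ℝ :=
  (-8*n - 30*n*B - 55*n*B^2 - 60*n*B^3 - 27*n*B^4 - 38*n^2 - 135*n^2*B - 215*n^2*B^2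
    - 126*n^2*B^3 - 78*n^3 - 245*n^3*B - 213*n^3*B^2 - 88*n^4 - 154*n^4*B - 40*n^5)
  + (8 + 30*B + 55*B^2 + 60*B^3 + 27*B^4 + 38*n + 125*n*B + 182*n*B^2 + 99*n*B^3 + 56*n^2
    + 144*n^2*B + 105*n^2*B^2 + 14*n^3 + 13*n^3*B - 20*n^4) * k
  + (10*B + 33*B^2 + 27*B^3 + 30*n + 113*n*B + 108*n*B^2 + 90*n^2 + 141*n^2*B + 60*n^3) * k^2
  + (-8 - 12*B - 16*n) * k^3

theorem certPoly_identity (n B k : ℝ) :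
    (B + n) * (B + n + 1) * ((2 * n - 3 * k) *
      ((4 + 5*n + 3*B) * (3*n + 2*B) * (3*n + 2*B + 1) * (1 + 2*n + 3*B + 3*k) *
          ((2 + B + 2*k) * (2 + 2*n + B - k)) -
        (1 + 5*n + 3*B) * (2 + B + n) * (4 + 2*n + 3*B + 3*k) *
          ((2*n + 2*B + k) * (2*n + 2*B + k + 1) * (2 + 2*n + B)))) =
    (n - 2*k) * (n - 2*k - 1) * (2*n + 2*B + k) * (2 + 2*n + B - k) * certPoly n B k -
      k * (n - k) * (1 + B + 2*k) * (2 + B + 2*k) * certPoly n B (k - 1) := by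
  unfold certPoly
  ring

theorem hypTerm_succ {n k : ℕ} (hk : 2 * (k + 1) ≤ n) (B : ℝ) :
    hypTerm n (k + 1) B *
        (((k : ℝ) + 1) * (n - (k + 1)) * (2 + B + 2 * k) * (3 + B + 2 * k)) =
      hypTerm n k B *
        ((n - 2 * k) * (n - 2 * k - 1) * (1 + 2 * n + B - k) * (2 * n + 2 * B + k)) := by
  obtain ⟨d, rfl⟩ := Nat.exists_eq_add_of_le hk
  unfold hypTerm
  have hd : poch (1 - ((2 * (k + 1) + d : ℕ) : ℝ)) k ≠ 0 := by
    refine poch_ne_zero fun i hi => ?_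
    have : (i : ℝ) < k := by exact_mod_cast hi
    push_cast
    have : (0 : ℝ) ≤ d := by positivity
    have : (0 : ℝ) ≤ k := by positivity
    linarith
  have hd' : (1 - ((2 * (k + 1) + d : ℕ) : ℝ)) + k ≠ 0 := by
    push_cast
    have : (0 : ℝ) ≤ d := by positivity
    have : (0 : ℝ) ≤ k := by positivity
    linarith
  have hf : (Nat.factorial k : ℝ) ≠ 0 := by positivity
  rw [show 2 * (k + 1) + d - 2 * (k + 1) = d by omega,
    show 2 * (k + 1) + d - 2 * k = d + 1 + 1 by omega, poch_succ' (2 + B + 2 * k),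
    poch_succ' (2 + B + 2 * k + 1),
    show (2 + B + 2 * (k : ℝ) + 1 + 1) = 2 + B + 2 * ((k + 1 : ℕ) : ℝ) by push_cast; ring,
    show 2 * (k + 1) = 2 * k + 1 + 1 by ring, poch_succ (-((2 * k + 1 + 1 + d : ℕ) : ℝ)) (2 * k + 1),
    poch_succ (-((2 * k + 1 + 1 + d : ℕ) : ℝ)) (2 * k),
    poch_succ (1 - ((2 * k + 1 + 1 + d : ℕ) : ℝ)), poch_succ _ k, poch_succ _ k,
    Nat.factorial_succ]
  rw [show 2 * (k + 1) = 2 * k + 1 + 1 by ring] at hd hd'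
  generalize poch (1 - ((2 * k + 1 + 1 + d : ℕ) : ℝ)) k = E at *
  generalize poch (-((2 * k + 1 + 1 + d : ℕ) : ℝ)) (2 * k) = E1
  generalize poch (-1 - 2 * ((2 * k + 1 + 1 + d : ℕ) : ℝ) - B) k = E2
  generalize poch (2 * ((2 * k + 1 + 1 + d : ℕ) : ℝ) + 2 * B) k = E3
  generalize poch (2 + B + 2 * ((k + 1 : ℕ) : ℝ)) d = E4
  push_cast at *
  have hk1 : (k : ℝ) + 1 ≠ 0 := by positivity
  field_simp
  ring

theorem hypTerm_add_one {n k : ℕ} (hk : 2 * k ≤ n) (B : ℝ) :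
    (2 * n + 2 * B) * (2 * n + 2 * B + 1) * hypTerm n k (B + 1) *
        ((2 + B + 2 * k) * (2 + 2 * n + B - k)) =
      hypTerm n k B * ((2 * n + 2 * B + k) * (2 * n + 2 * B + k + 1) * (2 + 2 * n + B) *
        (2 + B + n)) := by
  have e1 := mul_poch_add_one (-1 - 2 * (n : ℝ) - (B + 1)) k
  rw [show -1 - 2 * (n : ℝ) - (B + 1) + 1 = -1 - 2 * (n : ℝ) - B by ring] at e1
  have e2 := mul_poch_add_one (2 * (n : ℝ) + 2 * B) k
  have e3 := mul_poch_add_one (2 * (n : ℝ) + 2 * B + 1) k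
  rw [show 2 * (n : ℝ) + 2 * B + 1 + 1 = 2 * (n : ℝ) + 2 * (B + 1) by ring] at e3
  have e4 := mul_poch_add_one (2 + B + 2 * k) (n - 2 * k)
  rw [show 2 + B + 2 * (k : ℝ) + 1 = 2 + (B + 1) + 2 * k by ring, Nat.cast_sub hk] at e4
  push_cast at e4
  have e23 : (2 * (n : ℝ) + 2 * B) * (2 * n + 2 * B + 1) * poch (2 * (n : ℝ) + 2 * (B + 1)) k =
      poch (2 * (n : ℝ) + 2 * B) k * (2 * n + 2 * B + k) * (2 * n + 2 * B + k + 1) := by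
    linear_combination (2 * (n : ℝ) + 2 * B) * e3 + (2 * (n : ℝ) + 2 * B + 1 + k) * e2
  unfold hypTerm
  generalize poch (-(n : ℝ)) (2 * k) / ((Nat.factorial k : ℝ) * poch (1 - (n : ℝ)) k) = A
  generalize poch (-1 - 2 * (n : ℝ) - (B + 1)) k = U' at *
  generalize poch (-1 - 2 * (n : ℝ) - B) k = U at *
  generalize poch (2 * (n : ℝ) + 2 * (B + 1)) k = V' at *
  generalize poch (2 * (n : ℝ) + 2 * B) k = V at *
  generalize poch (2 + (B + 1) + 2 * (k : ℝ)) (n - 2 * k) = W' at *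
  generalize poch (2 + B + 2 * (k : ℝ)) (n - 2 * k) = W at *
  have hU : U' * (2 + 2 * n + B - k) = (2 + 2 * n + B) * U := by linear_combination e1
  have hW : (2 + B + 2 * k) * W' = W * (2 + B + n) := by linear_combination e4
  calc _ = A * (U' * (2 + 2 * n + B - k)) *
        ((2 * (n : ℝ) + 2 * B) * (2 * n + 2 * B + 1) * V') * ((2 + B + 2 * k) * W') := by ring
    _ = _ := by rw [hU, e23, hW]; ring

/-- The partial sums telescope. -/
theorem partial_sum_eq {n : ℕ} {B : ℝ} (hB : B < -2 - 2 * n) (m : ℕ) (hm : 2 * m ≤ n) :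
    (B + n) * (B + n + 1) * (2 + B + 2 * m) * ∑ k ∈ Finset.range (m + 1),
      ((4 + 5 * n + 3 * B) * (3 * n + 2 * B) * (3 * n + 2 * B + 1) *
          ((2 * (n : ℝ) - 3 * k) * (1 + 2 * n + 3 * B + 3 * k) * hypTerm n k B) -
        (1 + 5 * n + 3 * B) * ((2 * n + 2 * B) * (2 * n + 2 * B + 1)) *
          ((2 * (n : ℝ) - 3 * k) * (1 + 2 * n + 3 * (B + 1) + 3 * k) * hypTerm n k (B + 1))) =
      hypTerm n m B * ((n - 2 * m) * (n - 2 * m - 1) * (2 * n + 2 * B + m) *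
        certPoly n B m) := by
  have key : ∀ k : ℕ, 2 * k ≤ n →
      (B + n) * (B + n + 1) * ((2 + B + 2 * k) * (2 + 2 * n + B - k)) *
      ((4 + 5 * n + 3 * B) * (3 * n + 2 * B) * (3 * n + 2 * B + 1) *
          ((2 * (n : ℝ) - 3 * k) * (1 + 2 * n + 3 * B + 3 * k) * hypTerm n k B) -
        (1 + 5 * n + 3 * B) * ((2 * n + 2 * B) * (2 * n + 2 * B + 1)) *
          ((2 * (n : ℝ) - 3 * k) * (1 + 2 * n + 3 * (B + 1) + 3 * k) * hypTerm n k (B + 1))) =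
      hypTerm n k B *
        ((n - 2*k) * (n - 2*k - 1) * (2*n + 2*B + k) * (2 + 2*n + B - k) * certPoly n B k -
      k * (n - k) * (1 + B + 2*k) * (2 + B + 2*k) * certPoly n B (k - 1)) := by
    intro k hk
    have h := hypTerm_add_one hk B
    rw [← certPoly_identity]
    linear_combination (-(B + n) * (B + n + 1) * (1 + 5 * n + 3 * B) *
      (2 * (n : ℝ) - 3 * k) * (1 + 2 * n + 3 * (B + 1) + 3 * k)) * h
  induction m with
  | zero =>
    have h := key 0 hm
    have h0 : 2 + 2 * (n : ℝ) + B ≠ 0 := by linarith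
    rw [zero_add, Finset.sum_range_one]
    apply mul_right_cancel₀ h0
    push_cast at h ⊢
    linear_combination h
  | succ j ih =>
    have hj : 2 * ((j : ℝ) + 1) ≤ n := by exact_mod_cast hm
    have hj0 : (0 : ℝ) ≤ j := by positivity
    have ih := ih (by omega)
    have h := key (j + 1) hm
    have hs := hypTerm_succ hm B
    rw [Finset.sum_range_succ]
    generalize (∑ k ∈ Finset.range (j + 1), _ : ℝ) = S at ih ⊢
    push_cast at h ⊢
    rw [show (j : ℝ) + 1 - 1 = j by ring] at h
    have h1 : 2 + B + 2 * (j : ℝ) ≠ 0 := by linarith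
    have h2 : 1 + 2 * (n : ℝ) + B - j ≠ 0 := by linarith
    have hS : (B + n) * (B + n + 1) * (1 + 2 * (n : ℝ) + B - j) * S =
        hypTerm n (j + 1) B * (((j : ℝ) + 1) * (n - (j + 1)) * (3 + B + 2 * j)) *
          certPoly n B j := by
      apply mul_left_cancel₀ h1
      linear_combination (1 + 2 * (n : ℝ) + B - j) * ih - certPoly n B j * hs
    apply mul_right_cancel₀ h2
    linear_combination h + (2 + B + 2 * ((j : ℝ) + 1)) * hS

theorem isPolyFun_hypSum (n : ℕ) : IsPolyFun (hypSum n) := by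
  refine IsPolyFun.sum _ fun k => ?_
  have e1 : IsPolyFun fun B => (2 * (n : ℝ) - 3 * k) * (1 + 2 * n + 3 * B + 3 * k) := by
    convert IsPolyFun.affine ((2 * (n : ℝ) - 3 * k) * (1 + 2 * n + 3 * k))
      ((2 * (n : ℝ) - 3 * k) * 3) using 2
    ring
  refine e1.mul ((IsPolyFun.const _).mul ((IsPolyFun.mul ?_ ?_).mul ?_))
  · convert (IsPolyFun.poch k).comp (IsPolyFun.affine (-1 - 2 * (n : ℝ)) (-1)) using 3
    ring
  · exact (IsPolyFun.poch k).comp (IsPolyFun.affine _ _)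
  · convert (IsPolyFun.poch (n - 2 * k)).comp (IsPolyFun.affine (2 + 2 * (k : ℝ)) 1) using 3
    ring

theorem hypSum_add_one (n : ℕ) (B : ℝ) :
    (4 + 5 * n + 3 * B) * (3 * n + 2 * B) * (3 * n + 2 * B + 1) * hypSum n B =
      (1 + 5 * n + 3 * B) * ((2 * n + 2 * B) * (2 * n + 2 * B + 1)) * hypSum n (B + 1) := by
  refine IsPolyFun.eq_of_eq_sub_nat
    (f := fun B => (4 + 5 * n + 3 * B) * (3 * n + 2 * B) * (3 * n + 2 * B + 1) * hypSum n B)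
    (g := fun B => (1 + 5 * n + 3 * B) * ((2 * n + 2 * B) * (2 * n + 2 * B + 1)) *
      hypSum n (B + 1)) ?_ ?_ (-3 - 2 * (n : ℝ)) (fun m => ?_) B
  · exact (((IsPolyFun.affine _ _).mul (IsPolyFun.affine _ _)).mul
      ((IsPolyFun.affine _ _).add (.const _))).mul (isPolyFun_hypSum n)
  · exact ((IsPolyFun.affine _ _).mul ((IsPolyFun.affine _ _).mul
      ((IsPolyFun.affine _ _).add (.const _)))).mul
      ((isPolyFun_hypSum n).comp (IsPolyFun.id.add (.const _)))
  · have hm : (0 : ℝ) ≤ m := by positivity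
    have hn : (0 : ℝ) ≤ n := by positivity
    generalize hB : -3 - 2 * (n : ℝ) - m = B
    have h := partial_sum_eq (n := n) (B := B) (by linarith) (n / 2) (by omega)
    have hh : ((n : ℝ) - 2 * (n / 2 : ℕ)) * (n - 2 * (n / 2 : ℕ) - 1) = 0 := by
      rcases Nat.mod_two_eq_zero_or_one n with h0 | h0
      · have : (n : ℝ) = 2 * (n / 2 : ℕ) := by exact_mod_cast (by omega : n = 2 * (n / 2))
        rw [mul_eq_zero]; left; linarith
      · have : (n : ℝ) = 2 * (n / 2 : ℕ) + 1 := by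
          exact_mod_cast (by omega : n = 2 * (n / 2) + 1)
        rw [mul_eq_zero]; right; linarith
    have hn2 : 2 * ((n / 2 : ℕ) : ℝ) ≤ n := by exact_mod_cast (by omega : 2 * (n / 2) ≤ n)
    rw [hh, zero_mul, zero_mul, mul_zero, Finset.sum_sub_distrib, ← Finset.mul_sum,
      ← Finset.mul_sum] at h
    have hne : (B + n) * (B + n + 1) * (2 + B + 2 * (n / 2 : ℕ)) ≠ 0 :=
      mul_ne_zero (mul_ne_zero (by linarith) (by linarith)) (by linarith)
    exact sub_eq_zero.1 ((mul_eq_zero.1 h).resolve_left hne)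

theorem poch_neg_nat (m n : ℕ) :
    poch (-((m + n : ℕ) : ℝ)) n * Nat.factorial m = (-1) ^ n * Nat.factorial (m + n) := by
  induction n generalizing m with
  | zero => simp [poch_zero]
  | succ n ih =>
    have h := ih (m + 1)
    rw [show m + (n + 1) = m + 1 + n by ring, poch_succ]
    rw [Nat.factorial_succ] at h
    push_cast at h ⊢
    linear_combination (-1) * h

theorem hypSum_base {n : ℕ} (hn : 0 < n) :
    hypSum n (-1 - 2 * n) = n * (-2 - n) * poch (-2 - 2 * (n : ℝ)) n := by
  unfold hypSum
  rw [Finset.sum_eq_single 0]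
  · obtain ⟨d, rfl⟩ := Nat.exists_eq_add_of_lt hn
    have e1 := poch_neg_nat d (d + 1)
    have e2 := poch_neg_nat (d + 3) (d + 1)
    have hd : (Nat.factorial d : ℝ) ≠ 0 := by positivity
    have e3 := eq_div_of_mul_eq hd e1
    have hd' : (Nat.factorial (d + 3) : ℝ) ≠ 0 := by positivity
    have e4 := eq_div_of_mul_eq hd' e2
    unfold hypTerm
    simp only [mul_zero, poch_zero, Nat.factorial_zero, zero_add, Nat.sub_zero, Nat.cast_zero]
    rw [show (2 + (-1 - 2 * ((d + 1 : ℕ) : ℝ)) + 0) = -((d + (d + 1) : ℕ) : ℝ) by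
        push_cast; ring,
      show (-2 - 2 * ((d + 1 : ℕ) : ℝ)) = -((d + 3 + (d + 1) : ℕ) : ℝ) by push_cast; ring, e3, e4,
      show d + 3 + (d + 1) = d + (d + 1) + 1 + 1 + 1 by ring]
    simp only [Nat.factorial_succ]
    push_cast
    field_simp
    ring
  · intro k _ hk
    obtain ⟨j, rfl⟩ := Nat.exists_eq_succ_of_ne_zero hk
    have : poch (-1 - 2 * (n : ℝ) - (-1 - 2 * n)) (j + 1) = 0 := by
      rw [poch_succ', sub_self, zero_mul]
    rw [hypTerm, this, zero_mul, zero_mul, mul_zero, mul_zero]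
  · simp

theorem hypSum_eq {n : ℕ} (hn : 0 < n) (B : ℝ) :
    hypSum n B = n * (1 + 5 * n + 3 * B) * poch (2 * n + 2 * B) n := by
  refine IsPolyFun.eq_of_eq_sub_nat (isPolyFun_hypSum n)
    (g := fun B => n * (1 + 5 * n + 3 * B) * poch (2 * n + 2 * B) n)
    (((IsPolyFun.const _).mul (IsPolyFun.affine _ _)).mul
      ((IsPolyFun.poch n).comp (IsPolyFun.affine _ _))) (-1 - 2 * (n : ℝ)) (fun m => ?_) B
  have hn' : (1 : ℝ) ≤ n := by exact_mod_cast hn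
  induction m with
  | zero =>
    simp only [Nat.cast_zero, sub_zero, hypSum_base hn]
    rw [show 2 * (n : ℝ) + 2 * (-1 - 2 * n) = -2 - 2 * n by ring]
    ring
  | succ m ih =>
    have hm : (0 : ℝ) ≤ m := by positivity
    generalize hB : -1 - 2 * (n : ℝ) - (m + 1 : ℕ) = B
    rw [show -1 - 2 * (n : ℝ) - m = B + 1 by rw [← hB]; push_cast; ring] at ih
    push_cast at hB
    have h := hypSum_add_one n B
    have e2 := mul_poch_add_one (2 * (n : ℝ) + 2 * B) n
    have e3 := mul_poch_add_one (2 * (n : ℝ) + 2 * B + 1) n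
    rw [show 2 * (n : ℝ) + 2 * B + 1 + 1 = 2 * (n : ℝ) + 2 * (B + 1) by ring] at e3
    have hne : (4 + 5 * (n : ℝ) + 3 * B) * (3 * n + 2 * B) * (3 * n + 2 * B + 1) ≠ 0 :=
      mul_ne_zero (mul_ne_zero (by linarith) (by linarith)) (by linarith)
    apply mul_left_cancel₀ hne
    rw [h, ih]
    linear_combination (n * (1 + 5 * (n : ℝ) + 3 * B) * (4 + 5 * n + 3 * B)) *
      ((2 * (n : ℝ) + 2 * B) * e3 + (3 * (n : ℝ) + 2 * B + 1) * e2)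

/-- Lemma A6: a terminating ₆F₅ summation. -/
theorem lemA6 (n : ℕ) (hn : 0 < n) (B : ℝ) (h1 : poch (2 + B) n ≠ 0)
    (h2 : 1 + 2 * (n : ℝ) + 3 * B ≠ 0)
    (h3 : poch (B + (2 * (n : ℝ) + 1) / 3) (n / 2) ≠ 0) :
    ∑ k ∈ Finset.range (n / 2 + 1),
      (poch (4 / 3 + 2 * (n : ℝ) / 3 + B) k * poch (1 - 2 * (n : ℝ) / 3) k *
          poch (-(n : ℝ) / 2) k * poch ((1 - (n : ℝ)) / 2) k *
          poch (-1 - 2 * (n : ℝ) - B) k * poch (2 * (n : ℝ) + 2 * B) k) /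
        ((Nat.factorial k : ℝ) * poch (1 / 3 + 2 * (n : ℝ) / 3 + B) k *
          poch (-(2 * (n : ℝ)) / 3) k * poch (1 - (n : ℝ)) k * poch (1 + B / 2) k *
          poch (3 / 2 + B / 2) k) =
      (1 / 2) * ((1 + 5 * (n : ℝ) + 3 * B) / (1 + 2 * (n : ℝ) + 3 * B)) *
        (poch (2 * (n : ℝ) + 2 * B) n / poch (2 + B) n) := by
  have hn' : (1 : ℝ) ≤ n := by exact_mod_cast hn
  have hmain : hypSum n B / (2 * n * (1 + 2 * n + 3 * B) * poch (2 + B) n) =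
      (1 / 2) * ((1 + 5 * (n : ℝ) + 3 * B) / (1 + 2 * (n : ℝ) + 3 * B)) *
        (poch (2 * (n : ℝ) + 2 * B) n / poch (2 + B) n) := by
    rw [hypSum_eq hn]
    field_simp
  rw [← hmain, hypSum, Finset.sum_div]
  refine Finset.sum_congr rfl fun k hk => ?_
  have hk2 : 2 * k ≤ n := by have := Finset.mem_range.1 hk; omega
  have hkn : 2 * (k : ℝ) ≤ n := by exact_mod_cast hk2
  have hsplit : poch (2 + B) n = poch (2 + B) (2 * k) * poch (2 + B + 2 * k) (n - 2 * k) := by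
    conv_lhs => rw [← Nat.add_sub_cancel' hk2, poch_add]
    push_cast; rfl
  have hdup := poch_two_mul (2 + B) k
  rw [show (2 + B) / 2 = 1 + B / 2 by ring, show (2 + B + 1) / 2 = 3 / 2 + B / 2 by ring] at hdup
  have hdup' := poch_two_mul (-(n : ℝ)) k
  rw [show (-(n : ℝ) + 1) / 2 = (1 - n) / 2 by ring] at hdup'
  have q1 := mul_poch_add_one (1 / 3 + 2 * (n : ℝ) / 3 + B) k
  rw [show 1 / 3 + 2 * (n : ℝ) / 3 + B + 1 = 4 / 3 + 2 * n / 3 + B by ring] at q1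
  have q2 := mul_poch_add_one (-(2 * (n : ℝ)) / 3) k
  rw [show -(2 * (n : ℝ)) / 3 + 1 = 1 - 2 * n / 3 by ring] at q2
  have n1 : poch (1 / 3 + 2 * (n : ℝ) / 3 + B) k ≠ 0 := by
    refine poch_ne_zero fun i hi => ?_
    have := add_ne_zero_of_poch_ne_zero h3 (i := i) (by omega)
    intro h0
    exact this (by linear_combination h0)
  have n2 : poch (-(2 * (n : ℝ)) / 3) k ≠ 0 := by
    refine poch_ne_zero fun i hi => ?_
    have : (i : ℝ) < k := by exact_mod_cast hi
    linarith
  have n3 : poch (1 - (n : ℝ)) k ≠ 0 := by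
    refine poch_ne_zero fun i hi => ?_
    have : (i : ℝ) + 1 ≤ k := by exact_mod_cast hi
    have : (0 : ℝ) ≤ i := by positivity
    linarith
  rw [hsplit] at h1 ⊢
  obtain ⟨n4, n5⟩ := mul_ne_zero_iff.1 h1
  rw [hdup] at n4 ⊢
  obtain ⟨-, n6⟩ := mul_ne_zero_iff.1 n4
  obtain ⟨n7, n8⟩ := mul_ne_zero_iff.1 n6
  have hf : (Nat.factorial k : ℝ) ≠ 0 := by positivity
  have q1' : poch (4 / 3 + 2 * (n : ℝ) / 3 + B) k =
      poch (1 / 3 + 2 * (n : ℝ) / 3 + B) k * (1 + 2 * n + 3 * B + 3 * k) /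
        (1 + 2 * n + 3 * B) := by
    rw [eq_div_iff h2]; linear_combination 3 * q1
  have q2' : poch (1 - 2 * (n : ℝ) / 3) k =
      poch (-(2 * (n : ℝ)) / 3) k * (2 * n - 3 * k) / (2 * n) := by
    rw [eq_div_iff (by linarith)]; linear_combination (-3) * q2
  unfold hypTerm
  rw [q1', q2', hdup']
  generalize poch (1 / 3 + 2 * (n : ℝ) / 3 + B) k = E1 at *
  generalize poch (-(2 * (n : ℝ)) / 3) k = E2 at *
  generalize poch (1 - (n : ℝ)) k = E3 at *
  generalize poch (1 + B / 2) k = E4 at *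
  generalize poch (3 / 2 + B / 2) k = E5 at *
  generalize poch (2 + B + 2 * (k : ℝ)) (n - 2 * k) = E6 at *
  have hn0 : (n : ℝ) ≠ 0 := by linarith
  field_simp
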